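/- For every u ∈ L¹ with u ≥ 0 m-a.e. and all 0 < λ < μ one has T_μ u ≤ T_λ u m-a.e.; the limit Ku := lim_{k→∞} T_{1/k} u exists in L¹-norm for every u ∈ L¹; K is a positive contraction of L¹; and ‖Ku‖ = ‖u‖ − lim_{λ↓0} λ‖R(λ)u‖ for every u ≥ 0 m-a.e. In particular ‖Ku‖ = ‖u‖ for all u ≥ 0 (K is stochastic) if and only if S(t)u → 0 in L¹-norm as t → ∞ for every u ∈ L¹. -/

import Mathlib

open MeasureTheory Filter

namespace MeasureTheory.L1

variable {E : Type*} [MeasurableSpace E] {m : Measure E}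

theorem isOrderedModule : IsOrderedModule ℝ (Lp ℝ 1 m) :=
  .of_smul_nonneg fun c hc u hu => by
    rw [← Lp.coeFn_nonneg] at hu ⊢
    filter_upwards [hu, Lp.coeFn_smul c u] with x hx hcx
    rw [hcx]
    exact mul_nonneg hc hx

theorem integralCLM_apply_eq_integral (u : Lp ℝ 1 m) :
    integralCLM (E := ℝ) u = ∫ x, u x ∂m := by
  rw [← integral_eq, integral_eq_integral]

theorem integralCLM_apply_of_nonneg {u : Lp ℝ 1 m} (hu : 0 ≤ u) :
    integralCLM (E := ℝ) u = ‖u‖ := by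
  rw [integralCLM_apply_eq_integral, norm_eq_integral_norm]
  refine integral_congr_ae ?_
  filter_upwards [(Lp.coeFn_nonneg u).2 hu] with x hx
  exact (Real.norm_of_nonneg hx).symm

theorem norm_sub_of_le {u v : Lp ℝ 1 m} (hu : 0 ≤ u) (huv : u ≤ v) :
    ‖v - u‖ = ‖v‖ - ‖u‖ := by
  rw [← integralCLM_apply_of_nonneg (sub_nonneg.2 huv), map_sub,
    integralCLM_apply_of_nonneg hu, integralCLM_apply_of_nonneg (hu.trans huv)]

theorem norm_le_norm_of_le {u v : Lp ℝ 1 m} (hu : 0 ≤ u) (huv : u ≤ v) : ‖u‖ ≤ ‖v‖ :=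
  sub_nonneg.1 (norm_sub_of_le hu huv ▸ norm_nonneg _)

/-- Monotone convergence in `L¹`: a norm-bounded increasing sequence of nonnegative elements
converges in norm. -/
theorem exists_tendsto_of_monotone {f : ℕ → Lp ℝ 1 m} {C : ℝ} (hf : Monotone f)
    (h0 : ∀ n, 0 ≤ f n) (hC : ∀ n, ‖f n‖ ≤ C) : ∃ g, Tendsto f atTop (nhds g) := by
  refine cauchySeq_tendsto_of_complete ?_
  have hmono : Monotone fun n => ‖f n‖ := fun i j hij => norm_le_norm_of_le (h0 i) (hf hij)
  have hcauchy := (tendsto_atTop_ciSup hmono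
    ⟨C, Set.forall_mem_range.2 hC⟩).cauchySeq
  rw [Metric.cauchySeq_iff'] at hcauchy ⊢
  intro ε hε
  obtain ⟨N, hN⟩ := hcauchy ε hε
  refine ⟨N, fun n hn => ?_⟩
  rw [dist_eq_norm, norm_sub_of_le (h0 N) (hf hn)]
  exact (le_abs_self _).trans_lt (hN n hn)

end MeasureTheory.L1

theorem integral_exp_neg_mul_Ioi_zero {l : ℝ} (hl : 0 < l) :
    ∫ t in Set.Ioi (0 : ℝ), Real.exp (-l * t) = l⁻¹ := by
  rw [integral_exp_mul_Ioi (neg_lt_zero.2 hl)]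
  simp

section ContractiveOrbit

variable {X : Type*} [NormedAddCommGroup X] [NormedSpace ℝ X] {f : ℝ → X} {C l : ℝ}

theorem integrableOn_exp_neg_smul (hf : ContinuousOn f (Set.Ici 0))
    (hC : ∀ t, 0 ≤ t → ‖f t‖ ≤ C) (hl : 0 < l) :
    IntegrableOn (fun t => Real.exp (-l * t) • f t) (Set.Ioi 0) := by
  have hf' : ContinuousOn f (Set.Ioi 0) := hf.mono Set.Ioi_subset_Ici_self
  refine Integrable.mono' ((exp_neg_integrableOn_Ioi 0 hl).mul_const C)
    (ContinuousOn.aestronglyMeasurable (by fun_prop) measurableSet_Ioi) ?_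
  filter_upwards [ae_restrict_mem measurableSet_Ioi] with t ht
  rw [norm_smul, Real.norm_of_nonneg (Real.exp_nonneg _)]
  exact mul_le_mul_of_nonneg_left (hC t (Set.mem_Ioi.1 ht).le) (Real.exp_nonneg _)

/-- The Abel means of a bounded function tending to zero at infinity tend to zero. -/
theorem tendsto_mul_norm_integral_exp_neg_smul (hC : ∀ t, 0 ≤ t → ‖f t‖ ≤ C)
    (hf : Tendsto f atTop (nhds 0)) :
    Tendsto (fun l : ℝ => l * ‖∫ t in Set.Ioi (0 : ℝ), Real.exp (-l * t) • f t‖)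
      (nhdsWithin 0 (Set.Ioi 0)) (nhds 0) := by
  have hC0 : 0 ≤ C := (norm_nonneg _).trans (hC 0 le_rfl)
  have key : ∀ ε > 0, ∃ N : ℝ, ∀ l > 0,
      l * ‖∫ t in Set.Ioi (0 : ℝ), Real.exp (-l * t) • f t‖ ≤
        ε + l * (C * Real.exp N) := by
    intro ε hε
    obtain ⟨N, hN⟩ := Metric.tendsto_atTop.1 hf ε hε
    refine ⟨N, fun l hl => ?_⟩
    have hl1 : 0 < l + 1 := by linarith
    have hbound : ∀ t, 0 < t → ‖f t‖ ≤ ε + C * Real.exp N * Real.exp (-t) := by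
      intro t ht
      rcases le_total N t with h | h
      · have := (dist_zero_right (f t) ▸ hN t h).le
        have : 0 ≤ C * Real.exp N * Real.exp (-t) := by positivity
        linarith
      · rw [mul_assoc, ← Real.exp_add]
        have : C * 1 ≤ C * Real.exp (N + -t) :=
          mul_le_mul_of_nonneg_left (Real.one_le_exp (by linarith)) hC0
        linarith [hC t ht.le]
    have hle : ‖∫ t in Set.Ioi (0 : ℝ), Real.exp (-l * t) • f t‖ ≤
        ∫ t in Set.Ioi (0 : ℝ),
          (Real.exp (-l * t) * ε + Real.exp (-(l + 1) * t) * (C * Real.exp N)) := by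
      refine norm_integral_le_of_norm_le (((exp_neg_integrableOn_Ioi 0 hl).mul_const _).add
        ((exp_neg_integrableOn_Ioi 0 hl1).mul_const _)) ?_
      filter_upwards [ae_restrict_mem measurableSet_Ioi] with t ht
      rw [norm_smul, Real.norm_of_nonneg (Real.exp_nonneg _)]
      refine (mul_le_mul_of_nonneg_left (hbound t ht) (Real.exp_nonneg _)).trans_eq ?_
      rw [show -(l + 1) * t = -l * t + -t by ring, Real.exp_add]
      ring
    rw [integral_add ((exp_neg_integrableOn_Ioi 0 hl).mul_const _)
      ((exp_neg_integrableOn_Ioi 0 hl1).mul_const _), integral_mul_const, integral_mul_const,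
      integral_exp_neg_mul_Ioi_zero hl, integral_exp_neg_mul_Ioi_zero hl1] at hle
    refine (mul_le_mul_of_nonneg_left hle hl.le).trans ?_
    rw [mul_add, mul_inv_cancel_left₀ hl.ne']
    have : (l + 1)⁻¹ ≤ 1 := inv_le_one_of_one_le₀ (by linarith)
    have : (l + 1)⁻¹ * (C * Real.exp N) ≤ C * Real.exp N :=
      mul_le_of_le_one_left (by positivity) this
    gcongr
  rw [Metric.tendsto_nhds]
  intro ε hε
  obtain ⟨N, hN⟩ := key (ε / 2) (half_pos hε)
  have hlim : Tendsto (fun l : ℝ => l * (C * Real.exp N)) (nhdsWithin 0 (Set.Ioi 0)) (nhds 0) := by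
    have : Tendsto (fun l : ℝ => l * (C * Real.exp N)) (nhds 0) (nhds (0 * (C * Real.exp N))) :=
      tendsto_id.mul_const _
    rw [zero_mul] at this
    exact this.mono_left nhdsWithin_le_nhds
  filter_upwards [hlim.eventually_lt_const (half_pos hε), self_mem_nhdsWithin] with l hlt hl
  have hl' : 0 < l := hl
  rw [dist_zero_right, Real.norm_of_nonneg (by positivity)]
  linarith [hN l hl']

end ContractiveOrbit

/-- Abel means of the orbit of a nonnegative function dominate any lower bound for the norms along
the orbit. -/
theorem MeasureTheory.L1.le_mul_norm_integral_exp_neg_smul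
    {E : Type*} [MeasurableSpace E] {m : Measure E} {f : ℝ → Lp ℝ 1 m} {C a l : ℝ}
    (hf : ContinuousOn f (Set.Ici 0)) (h0 : ∀ t, 0 ≤ t → 0 ≤ f t)
    (hC : ∀ t, 0 ≤ t → ‖f t‖ ≤ C) (ha : ∀ t, 0 ≤ t → a ≤ ‖f t‖) (hl : 0 < l) :
    a ≤ l * ‖∫ t in Set.Ioi (0 : ℝ), Real.exp (-l * t) • f t‖ := by
  have hint := integrableOn_exp_neg_smul hf hC hl
  have := isOrderedModule (m := m)
  have hnonneg : 0 ≤ ∫ t in Set.Ioi (0 : ℝ), Real.exp (-l * t) • f t := by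
    refine integral_nonneg_of_ae ?_
    filter_upwards [ae_restrict_mem measurableSet_Ioi] with t ht
    exact smul_nonneg (Real.exp_nonneg _) (h0 t (Set.mem_Ioi.1 ht).le)
  rw [← integralCLM_apply_of_nonneg hnonneg, ← ContinuousLinearMap.integral_comp_comm _ hint]
  have hle : ∫ t in Set.Ioi (0 : ℝ), Real.exp (-l * t) * a ≤
      ∫ t in Set.Ioi (0 : ℝ), integralCLM (E := ℝ) (Real.exp (-l * t) • f t) := by
    refine setIntegral_mono_on ((exp_neg_integrableOn_Ioi 0 hl).mul_const _)
      ((integralCLM (E := ℝ) (μ := m)).integrable_comp hint) measurableSet_Ioi fun t ht => ?_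
    have ht' : 0 ≤ t := (Set.mem_Ioi.1 ht).le
    rw [map_smul, integralCLM_apply_of_nonneg (h0 t ht'), smul_eq_mul]
    exact mul_le_mul_of_nonneg_left (ha t ht') (Real.exp_nonneg _)
  rw [integral_mul_const, integral_exp_neg_mul_Ioi_zero hl] at hle
  calc a = l * (l⁻¹ * a) := (mul_inv_cancel_left₀ hl.ne' a).symm
    _ ≤ _ := mul_le_mul_of_nonneg_left hle hl.le

/-- In the Kato–Voigt perturbation setting: `T_μ u ≤ T_λ u` for `u ≥ 0`
and `0 < λ < μ`; the limit `K u = lim_k T_{1/k} u` exists in `L¹` for every `u`; `K` is a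
positive contraction; `‖K u‖ = ‖u‖ − lim_{λ↓0} λ‖R(λ)u‖` for `u ≥ 0`; and `K` is stochastic
(`‖K u‖ = ‖u‖` for all `u ≥ 0`) iff `S(t)u → 0` for every `u ∈ L¹`. -/
theorem K_limit_exists_positive_contraction
    {E : Type*} [MeasurableSpace E] (m : Measure E) [SigmaFinite m]
    (S : ℝ → Lp ℝ 1 m →L[ℝ] Lp ℝ 1 m)
    (hS0 : S 0 = 1)
    (hSsemi : ∀ s t : ℝ, 0 ≤ s → 0 ≤ t → S (s + t) = (S s).comp (S t))
    (hSpos : ∀ t : ℝ, 0 ≤ t → ∀ u : Lp ℝ 1 m, 0 ≤ u → 0 ≤ S t u)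
    (hScontr : ∀ t : ℝ, 0 ≤ t → ∀ u : Lp ℝ 1 m, ‖S t u‖ ≤ ‖u‖)
    (hScont : ∀ u : Lp ℝ 1 m, ContinuousOn (fun t => S t u) (Set.Ici 0))
    (domA : Set (Lp ℝ 1 m)) (A : Lp ℝ 1 m → Lp ℝ 1 m)
    (hdomA : domA = {u | ∃ v : Lp ℝ 1 m,
      Tendsto (fun t : ℝ => t⁻¹ • (S t u - u)) (nhdsWithin 0 (Set.Ioi 0)) (nhds v)})
    (hA : ∀ u ∈ domA,
      Tendsto (fun t : ℝ => t⁻¹ • (S t u - u)) (nhdsWithin 0 (Set.Ioi 0)) (nhds (A u)))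
    (R : ℝ → Lp ℝ 1 m → Lp ℝ 1 m)
    (hR : ∀ l : ℝ, 0 < l → ∀ u : Lp ℝ 1 m,
      R l u = ∫ t in Set.Ioi (0 : ℝ), Real.exp (-l * t) • S t u)
    (hRmem : ∀ l : ℝ, 0 < l → ∀ u : Lp ℝ 1 m, R l u ∈ domA)
    (hRA : ∀ l : ℝ, 0 < l → ∀ u : Lp ℝ 1 m, A (R l u) = l • R l u - u)
    (B : Lp ℝ 1 m → Lp ℝ 1 m)
    (hBadd : ∀ u ∈ domA, ∀ v ∈ domA, B (u + v) = B u + B v)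
    (hBsmul : ∀ (c : ℝ), ∀ u ∈ domA, B (c • u) = c • B u)
    (hBpos : ∀ u ∈ domA, 0 ≤ u → 0 ≤ B u)
    (hABint : ∀ u ∈ domA, 0 ≤ u → ∫ x, (A u x + B u x) ∂m = 0)
    (T : ℝ → Lp ℝ 1 m → Lp ℝ 1 m)
    (hT : ∀ (l : ℝ) (u : Lp ℝ 1 m), T l u = B (R l u))
    (hTpos : ∀ l : ℝ, 0 < l → ∀ u : Lp ℝ 1 m, 0 ≤ u → 0 ≤ T l u)
    (hTcontr : ∀ l : ℝ, 0 < l → ∀ u : Lp ℝ 1 m, ‖T l u‖ ≤ ‖u‖)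
    :
    (∀ u : Lp ℝ 1 m, 0 ≤ u → ∀ l μ : ℝ, 0 < l → l < μ → T μ u ≤ T l u) ∧
    ∃ K : Lp ℝ 1 m → Lp ℝ 1 m,
      (∀ u : Lp ℝ 1 m, Tendsto (fun k : ℕ => T (1 / (k : ℝ)) u) atTop (nhds (K u))) ∧
      (∀ u : Lp ℝ 1 m, 0 ≤ u → 0 ≤ K u) ∧
      (∀ u : Lp ℝ 1 m, ‖K u‖ ≤ ‖u‖) ∧
      (∀ u : Lp ℝ 1 m, 0 ≤ u → ∃ c : ℝ,
        Tendsto (fun l : ℝ => l * ‖R l u‖) (nhdsWithin 0 (Set.Ioi 0)) (nhds c) ∧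
        ‖K u‖ = ‖u‖ - c) ∧
      ((∀ u : Lp ℝ 1 m, 0 ≤ u → ‖K u‖ = ‖u‖) ↔
        (∀ u : Lp ℝ 1 m, Tendsto (fun t : ℝ => S t u) atTop (nhds 0))) := by
  have := L1.isOrderedModule (m := m)
  have hint (u : Lp ℝ 1 m) {l : ℝ} (hl : 0 < l) :
      IntegrableOn (fun t => Real.exp (-l * t) • S t u) (Set.Ioi 0) :=
    integrableOn_exp_neg_smul (hScont u) (fun t ht => hScontr t ht u) hl
  have hRpos (l : ℝ) (hl : 0 < l) (u : Lp ℝ 1 m) (hu : 0 ≤ u) : 0 ≤ R l u := by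
    rw [hR l hl]
    refine integral_nonneg_of_ae ?_
    filter_upwards [ae_restrict_mem measurableSet_Ioi] with t ht
    exact smul_nonneg (Real.exp_nonneg _) (hSpos t (Set.mem_Ioi.1 ht).le u hu)
  have hRmono (u : Lp ℝ 1 m) (hu : 0 ≤ u) (l μ : ℝ) (hl : 0 < l) (hlμ : l < μ) :
      R μ u ≤ R l u := by
    rw [hR l hl, hR μ (hl.trans hlμ)]
    refine setIntegral_mono_on (hint u (hl.trans hlμ)) (hint u hl) measurableSet_Ioi
      fun t ht => ?_
    have ht' : 0 ≤ t := (Set.mem_Ioi.1 ht).le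
    refine smul_le_smul_of_nonneg_right (Real.exp_le_exp.2 ?_) (hSpos t ht' u hu)
    nlinarith
  have hRsub (l : ℝ) (hl : 0 < l) (u v : Lp ℝ 1 m) : R l (u - v) = R l u - R l v := by
    rw [hR l hl, hR l hl, hR l hl, ← integral_sub (hint u hl) (hint v hl)]
    simp only [map_sub, smul_sub]
  have hdom_sub {u v : Lp ℝ 1 m} (hu : u ∈ domA) (hv : v ∈ domA) : u - v ∈ domA := by
    rw [hdomA]
    refine ⟨A u - A v, ((hA u hu).sub (hA v hv)).congr fun t => ?_⟩
    rw [map_sub, ← smul_sub]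
    congr 1
    abel
  have hBsub {u v : Lp ℝ 1 m} (hu : u ∈ domA) (hv : v ∈ domA) : B (u - v) = B u - B v := by
    rw [eq_sub_iff_add_eq, ← hBadd _ (hdom_sub hu hv) _ hv, sub_add_cancel]
  have hTmono (u : Lp ℝ 1 m) (hu : 0 ≤ u) (l μ : ℝ) (hl : 0 < l) (hlμ : l < μ) :
      T μ u ≤ T l u := by
    have hμ := hl.trans hlμ
    rw [hT, hT, ← sub_nonneg, ← hBsub (hRmem l hl u) (hRmem μ hμ u)]
    exact hBpos _ (hdom_sub (hRmem l hl u) (hRmem μ hμ u))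
      (sub_nonneg.2 (hRmono u hu l μ hl hlμ))
  have hTsub (l : ℝ) (hl : 0 < l) (u v : Lp ℝ 1 m) : T l (u - v) = T l u - T l v := by
    rw [hT, hT, hT, hRsub l hl, hBsub (hRmem l hl u) (hRmem l hl v)]
  have hTnorm (u : Lp ℝ 1 m) (hu : 0 ≤ u) (l : ℝ) (hl : 0 < l) :
      ‖T l u‖ = ‖u‖ - l * ‖R l u‖ := by
    have h := hABint _ (hRmem l hl u) (hRpos l hl u hu)
    rw [integral_add (L1.integrable_coeFn _) (L1.integrable_coeFn _),
      ← L1.integralCLM_apply_eq_integral, ← L1.integralCLM_apply_eq_integral, ← hT,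
      L1.integralCLM_apply_of_nonneg (hTpos l hl u hu), hRA l hl, map_sub, map_smul,
      L1.integralCLM_apply_of_nonneg hu, L1.integralCLM_apply_of_nonneg (hRpos l hl u hu),
      smul_eq_mul] at h
    linarith
  have hlim_pos (u : Lp ℝ 1 m) (hu : 0 ≤ u) :
      ∃ v, Tendsto (fun k : ℕ => T (1 / (k : ℝ)) u) atTop (nhds v) := by
    have hpos (n : ℕ) : (0 : ℝ) < 1 / ((n + 1 : ℕ) : ℝ) := by positivity
    have hmono : Monotone fun n : ℕ => T (1 / ((n + 1 : ℕ) : ℝ)) u := by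
      refine monotone_nat_of_le_succ fun n => hTmono u hu _ _ (hpos _) ?_
      exact one_div_lt_one_div_of_lt (by positivity) (by push_cast; linarith)
    obtain ⟨v, hv⟩ := L1.exists_tendsto_of_monotone hmono (fun n => hTpos _ (hpos n) u hu)
      fun n => hTcontr _ (hpos n) u
    exact ⟨v, (tendsto_add_atTop_iff_nat 1).1 hv⟩
  have hevpos : ∀ᶠ k : ℕ in atTop, (0 : ℝ) < 1 / (k : ℝ) := by
    filter_upwards [eventually_gt_atTop 0] with k hk
    positivity
  have hlim (u : Lp ℝ 1 m) :
      ∃ v, Tendsto (fun k : ℕ => T (1 / (k : ℝ)) u) atTop (nhds v) := by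
    obtain ⟨v, hv⟩ := hlim_pos u⁺ (posPart_nonneg u)
    obtain ⟨w, hw⟩ := hlim_pos u⁻ (negPart_nonneg u)
    refine ⟨v - w, (hv.sub hw).congr' ?_⟩
    filter_upwards [hevpos] with k hk
    rw [← hTsub _ hk, posPart_sub_negPart]
  choose K hK using hlim
  have hKnorm (u : Lp ℝ 1 m) (hu : 0 ≤ u) :
      Tendsto (fun l : ℝ => l * ‖R l u‖) (nhdsWithin 0 (Set.Ioi 0)) (nhds (‖u‖ - ‖K u‖)) := by
    have hanti : AntitoneOn (fun l => ‖T l u‖) (Set.Ioi 0) := fun l hl μ hμ hlμ => by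
      rcases hlμ.eq_or_lt with rfl | h
      · exact le_rfl
      · exact L1.norm_le_norm_of_le (hTpos μ hμ u hu) (hTmono u hu l μ hl h)
    have hbdd : BddAbove ((fun l => ‖T l u‖) '' Set.Ioi 0) :=
      ⟨‖u‖, Set.forall_mem_image.2 fun l hl => hTcontr l hl u⟩
    have hTlim := hanti.tendsto_nhdsGT hbdd
    have hseq : Tendsto (fun k : ℕ => 1 / (k : ℝ)) atTop (nhdsWithin 0 (Set.Ioi 0)) :=
      tendsto_nhdsWithin_iff.2 ⟨tendsto_one_div_atTop_nhds_zero_nat, hevpos⟩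
    rw [tendsto_nhds_unique (hTlim.comp hseq) (hK u).norm] at hTlim
    refine (tendsto_const_nhds.sub hTlim).congr' ?_
    filter_upwards [self_mem_nhdsWithin] with l hl
    rw [hTnorm u hu l hl, sub_sub_cancel]
  refine ⟨hTmono, K, hK, fun u hu => ?_, fun u => ?_,
    fun u hu => ⟨_, hKnorm u hu, (sub_sub_cancel _ _).symm⟩, fun hst => ?_, fun hS u hu => ?_⟩
  · exact ge_of_tendsto (hK u) (hevpos.mono fun k hk => hTpos _ hk u hu)
  · exact le_of_tendsto (hK u).norm (hevpos.mono fun k hk => hTcontr _ hk u)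
  · have hpos (u : Lp ℝ 1 m) (hu : 0 ≤ u) : Tendsto (fun t => S t u) atTop (nhds 0) := by
      have hbelow (a : ℝ) (ha : ∀ t, 0 ≤ t → a ≤ ‖S t u‖) : a ≤ 0 := by
        have h := hKnorm u hu
        rw [hst u hu, sub_self] at h
        refine ge_of_tendsto h ?_
        filter_upwards [self_mem_nhdsWithin] with l hl
        rw [hR l hl]
        exact L1.le_mul_norm_integral_exp_neg_smul (hScont u) (fun t ht => hSpos t ht u hu)
          (fun t ht => hScontr t ht u) ha hl
      rw [Metric.tendsto_atTop]
      intro ε hε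
      by_contra! hfar
      refine hε.not_ge (hbelow ε fun s hs => ?_)
      obtain ⟨t, hst', ht⟩ := hfar s
      rw [dist_zero_right] at ht
      refine ht.trans ?_
      rw [← sub_add_cancel t s, hSsemi (t - s) s (sub_nonneg.2 hst') hs]
      exact hScontr _ (sub_nonneg.2 hst') _
    intro u
    have h := (hpos u⁺ (posPart_nonneg u)).sub (hpos u⁻ (negPart_nonneg u))
    simpa only [← map_sub, posPart_sub_negPart, sub_zero] using h
  · have h : Tendsto (fun l : ℝ => l * ‖R l u‖) (nhdsWithin 0 (Set.Ioi 0)) (nhds 0) := by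
      refine (tendsto_mul_norm_integral_exp_neg_smul (fun t ht => hScontr t ht u) (hS u)).congr' ?_
      filter_upwards [self_mem_nhdsWithin] with l hl
      rw [hR l hl]
    linarith [tendsto_nhds_unique (hKnorm u hu) h]
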